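/- arXiv:2307.00358 — 3 statements merged into one kernel-verified Lean document; each statement's English description precedes it below -/
import Mathlib

section
/- Assume f ∈ C¹,¹_ν(ℝⁿ). Let f̂ be the affine function interpolating f on an affinely independent set Θ = {x₁,…,x_{n+1}} ⊂ ℝⁿ, and let x ∈ ℝⁿ have barycentric coordinates ℓ₁,…,ℓ_{n+1} with respect to Θ. Define w = (x + Σ_{i=1}^{n+1} |ℓ_i| x_i) / (1 + Σ_{i=1}^{n+1} |ℓ_i|). Then |f̂(x) − f(x)| ≤ (ν/2)(‖x − w‖² + Σ_{i=1}^{n+1} |ℓ_i| ‖x_i − w‖²). -/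
open scoped InnerProductSpace

/-- First-order Taylor bound for a function whose gradient is Lipschitz with constant `ν`. -/
theorem abs_sub_sub_inner_gradient_le_of_lipschitz {E : Type*} [NormedAddCommGroup E]
    [InnerProductSpace ℝ E] [CompleteSpace E] {ν : ℝ} {f : E → ℝ} (hdiff : Differentiable ℝ f)
    (hlip : ∀ u v, ‖gradient f u - gradient f v‖ ≤ ν * ‖u - v‖) (w y : E) :
    |f y - f w - ⟪gradient f w, y - w⟫_ℝ| ≤ ν / 2 * ‖y - w‖ ^ 2 := by
  have hderiv (t : ℝ) : HasDerivAt
      (fun s : ℝ => f (w + s • (y - w)) - f w - s * ⟪gradient f w, y - w⟫_ℝ)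
      ⟪gradient f (w + t • (y - w)) - gradient f w, y - w⟫_ℝ t := by
    have hline : HasDerivAt (fun s : ℝ => w + s • (y - w)) (y - w) t := by
      simpa using ((hasDerivAt_id t).smul_const (y - w)).const_add w
    have hcomp := (hdiff (w + t • (y - w))).hasGradientAt.hasFDerivAt.comp_hasDerivAt t hline
    have hlin := (hasDerivAt_id t).mul_const ⟪gradient f w, y - w⟫_ℝ
    refine ((hcomp.sub_const (f w)).sub hlin).congr_deriv ?_
    rw [InnerProductSpace.toDual_apply_apply, one_mul, inner_sub_left]
  have hbound (t : ℝ) : HasDerivAt (fun s : ℝ => ν / 2 * ‖y - w‖ ^ 2 * s ^ 2)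
      (ν * ‖y - w‖ ^ 2 * t) t := by
    refine ((hasDerivAt_pow 2 t).const_mul (ν / 2 * ‖y - w‖ ^ 2)).congr_deriv ?_
    norm_num
    ring
  have key := image_norm_le_of_norm_deriv_right_le_deriv_boundary (a := 0) (b := 1)
    (fun t _ => (hderiv t).continuousAt.continuousWithinAt)
    (fun t _ => (hderiv t).hasDerivWithinAt) (by simp) hbound
    (fun t ht => by
      calc ‖⟪gradient f (w + t • (y - w)) - gradient f w, y - w⟫_ℝ‖
          ≤ ‖gradient f (w + t • (y - w)) - gradient f w‖ * ‖y - w‖ := norm_inner_le_norm _ _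
        _ ≤ ν * ‖w + t • (y - w) - w‖ * ‖y - w‖ := by gcongr; exact hlip _ _
        _ = ν * ‖y - w‖ ^ 2 * t := by
          rw [add_sub_cancel_left, norm_smul, Real.norm_of_nonneg ht.1]
          ring)
    (Set.right_mem_Icc.2 zero_le_one)
  simpa using key

/-- An affine map takes an affine combination to the same combination of the values. -/
theorem AffineMap.map_sum_smul_of_sum_eq_one {ι E F : Type*} [Fintype ι] [AddCommGroup E]
    [Module ℝ E] [AddCommGroup F] [Module ℝ F] (g : E →ᵃ[ℝ] F) (x : ι → E) {ℓ : ι → ℝ}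
    (hsum : ∑ i, ℓ i = 1) : g (∑ i, ℓ i • x i) = ∑ i, ℓ i • g (x i) := by
  have h (y : E) : g y = g.linear y + g 0 := congrFun g.decomp y
  rw [h]
  simp_rw [fun i => h (x i), smul_add, Finset.sum_add_distrib, ← Finset.sum_smul, hsum, map_sum,
    map_smul, one_smul]

/-- Improved error bound for linear interpolation/extrapolation with the optimal point `w`. -/
theorem stmt_4 (n : ℕ) (ν : ℝ) (hν : 0 < ν)
    (f : EuclideanSpace ℝ (Fin n) → ℝ)
    (hdiff : Differentiable ℝ f)
    (hlip : ∀ u v, ‖gradient f u - gradient f v‖ ≤ ν * ‖u - v‖)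
    (x : Fin (n + 1) → EuclideanSpace ℝ (Fin n)) (hx : AffineIndependent ℝ x)
    (p : EuclideanSpace ℝ (Fin n)) (ℓ : Fin (n + 1) → ℝ)
    (hsum : ∑ i, ℓ i = 1) (hbary : ∑ i, ℓ i • x i = p)
    (fhat : EuclideanSpace ℝ (Fin n) →ᵃ[ℝ] ℝ)
    (hfhat : ∀ i, fhat (x i) = f (x i))
    (w : EuclideanSpace ℝ (Fin n))
    (hw : w = (1 + ∑ i, |ℓ i|)⁻¹ • (p + ∑ i, |ℓ i| • x i)) :
    |fhat p - f p| ≤ ν / 2 * (‖p - w‖ ^ 2 + ∑ i, |ℓ i| * ‖x i - w‖ ^ 2) := by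
  set R : EuclideanSpace ℝ (Fin n) → ℝ := fun y => f y - f w - ⟪gradient f w, y - w⟫_ℝ with hR
  have hRle (y) : |R y| ≤ ν / 2 * ‖y - w‖ ^ 2 :=
    abs_sub_sub_inner_gradient_le_of_lipschitz hdiff hlip w y
  have hfp : fhat p = ∑ i, ℓ i * f (x i) := by
    rw [← hbary, fhat.map_sum_smul_of_sum_eq_one x hsum]
    simp [hfhat]
  have hinner : ∑ i, ℓ i * ⟪gradient f w, x i - w⟫_ℝ = ⟪gradient f w, p - w⟫_ℝ := by
    simp_rw [← real_inner_smul_right, ← inner_sum, smul_sub, Finset.sum_sub_distrib,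
      ← Finset.sum_smul, hsum, hbary, one_smul]
  have herr : fhat p - f p = ∑ i, ℓ i * R (x i) - R p := by
    simp only [hR, mul_sub, Finset.sum_sub_distrib, ← Finset.sum_mul, hsum, hinner, hfp]
    ring
  calc |fhat p - f p| ≤ |∑ i, ℓ i * R (x i)| + |R p| := herr ▸ abs_sub _ _
    _ ≤ ∑ i, |ℓ i| * |R (x i)| + |R p| := by
      gcongr
      simpa only [abs_mul] using Finset.abs_sum_le_sum_abs (fun i => ℓ i * R (x i)) Finset.univ
    _ ≤ ∑ i, |ℓ i| * (ν / 2 * ‖x i - w‖ ^ 2) + ν / 2 * ‖p - w‖ ^ 2 := by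
      gcongr <;> exact hRle _
    _ = ν / 2 * (‖p - w‖ ^ 2 + ∑ i, |ℓ i| * ‖x i - w‖ ^ 2) := by
      rw [mul_add, Finset.mul_sum, add_comm]
      congr 1
      exact Finset.sum_congr rfl fun i _ => by ring
end

section
/- Let Θ = {x₁,…,x_{n+1}} ⊂ ℝⁿ be affinely independent, let x ∈ ℝⁿ have barycentric coordinates ℓ₁,…,ℓ_{n+1} with respect to Θ, and set x₀ = x, ℓ₀ = −1, G = Σ_{i=0}^{n+1} ℓ_i x_i x_iᵀ. If f(u) = c + g·u + (1/2)(Hu)·u is a quadratic function with c ∈ ℝ, g ∈ ℝⁿ and symmetric H ∈ ℝ^{n×n}, and f̂ is the affine function interpolating f on Θ, then f̂(x) − f(x) = (1/2) Tr(G H). -/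
open Matrix

/-- An affine map to a module commutes with linear combinations whose weights sum to one. -/
theorem AffineMap.map_sum_smul_of_sum_eq_one_s7 {k V W ι : Type*} [Ring k]
    [AddCommGroup V] [Module k V] [AddCommGroup W] [Module k W] [Fintype ι]
    (φ : V →ᵃ[k] W) (w : ι → k) (v : ι → V) (hw : ∑ i, w i = 1) :
    φ (∑ i, w i • v i) = ∑ i, w i • φ (v i) := by
  have h (u : V) : φ u = φ.linear u + φ 0 := congrFun φ.decomp u
  rw [h, map_sum, Finset.sum_congr rfl fun i _ => congrArg (w i • ·) (h (v i))]
  simp only [map_smul, smul_add, Finset.sum_add_distrib, ← Finset.sum_smul, hw, one_smul]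

theorem Matrix.trace_vecMulVec_self_mul {R m : Type*} [CommSemiring R] [Fintype m]
    (u : m → R) (A : Matrix m m R) :
    (vecMulVec u u * A).trace = (A *ᵥ u) ⬝ᵥ u := by
  rw [vecMulVec_mul, trace_vecMulVec, dotProduct_comm, ← dotProduct_mulVec, dotProduct_comm]

/-- For a quadratic `f(u) = c + g·u + (1/2)(Hu)·u` with symmetric `H`, the linear
interpolation error at `x` equals `(1/2) Tr(G H)`, where
`G = Σ_{i=0}^{n+1} ℓ_i x_i x_iᵀ` (with `x₀ = x`, `ℓ₀ = −1`). -/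
theorem stmt_7 (n : ℕ)
    (x : Fin (n + 1) → (Fin n → ℝ)) (hx : AffineIndependent ℝ x)
    (p : Fin n → ℝ) (ℓ : Fin (n + 1) → ℝ)
    (hsum : ∑ i, ℓ i = 1) (hbary : ∑ i, ℓ i • x i = p)
    (c : ℝ) (g : Fin n → ℝ) (H : Matrix (Fin n) (Fin n) ℝ) (hH : H.IsSymm)
    (f : (Fin n → ℝ) → ℝ)
    (hf : ∀ u, f u = c + g ⬝ᵥ u + (1 / 2) * (H.mulVec u ⬝ᵥ u))
    (fhat : (Fin n → ℝ) →ᵃ[ℝ] ℝ)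
    (hfhat : ∀ i, fhat (x i) = f (x i))
    (G : Matrix (Fin n) (Fin n) ℝ)
    (hG : G = (-1 : ℝ) • vecMulVec p p + ∑ i, ℓ i • vecMulVec (x i) (x i)) :
    fhat p - f p = 1 / 2 * (G * H).trace := by
  have hfp : fhat p = ∑ i, ℓ i * f (x i) := by
    rw [← hbary, fhat.map_sum_smul_of_sum_eq_one_s7 ℓ x hsum]
    simp only [hfhat, smul_eq_mul]
  have hg : ∑ i, ℓ i * (g ⬝ᵥ x i) = g ⬝ᵥ p := by
    simp only [← hbary, dotProduct_sum, dotProduct_smul, smul_eq_mul]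
  have hc : ∑ i, ℓ i * f (x i) =
      c + g ⬝ᵥ p + (1 / 2) * ∑ i, ℓ i * ((H *ᵥ x i) ⬝ᵥ x i) := by
    simp only [hf, mul_add, Finset.sum_add_distrib, ← Finset.sum_mul, hsum, hg, one_mul,
      Finset.mul_sum, mul_left_comm (1 / 2 : ℝ)]
  have ht : (G * H).trace = -((H *ᵥ p) ⬝ᵥ p) + ∑ i, ℓ i * ((H *ᵥ x i) ⬝ᵥ x i) := by
    simp only [hG, Matrix.add_mul, Matrix.sum_mul, Matrix.smul_mul, trace_add, trace_sum,
      trace_smul, trace_vecMulVec_self_mul, smul_eq_mul, neg_one_mul]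
  rw [hfp, hc, ht, hf p]
  ring
end

section
/- Assume f ∈ C¹,¹_ν(ℝⁿ). Let f̂ be the affine function interpolating f on an affinely independent set Θ = {x₁,…,x_{n+1}} ⊂ ℝⁿ, and for i = 1,…,n+1 let ℓ_i: ℝⁿ → ℝ be the Lagrange polynomials of Θ (the affine functions with ℓ_i(x_j) = 1 if i = j and 0 otherwise), with constant gradients Dℓ_i. Then for every x ∈ ℝⁿ, the gradient approximation error satisfies ‖Df̂(x) − Df(x)‖ ≤ (ν/2) Σ_{i=1}^{n+1} ‖Dℓ_i(x)‖ ‖x_i − x‖². -/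
open scoped InnerProductSpace

/-- An affine function vanishing at the vertices of a full-dimensional simplex has zero gradient. -/
theorem AffineIndependent.eq_zero_of_add_inner_eq_zero {n : ℕ}
    {x : Fin (n + 1) → EuclideanSpace ℝ (Fin n)} (hx : AffineIndependent ℝ x)
    (a : ℝ) (w : EuclideanSpace ℝ (Fin n)) (h : ∀ j, a + ⟪w, x j⟫_ℝ = 0) : w = 0 := by
  have htop : vectorSpan ℝ (Set.range x) = ⊤ :=
    hx.vectorSpan_eq_top_of_card_eq_finrank_add_one (by simp)
  have hle : vectorSpan ℝ (Set.range x) ≤ LinearMap.ker (innerₛₗ ℝ w) := by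
    rw [vectorSpan_eq_span_vsub_set_right ℝ (Set.mem_range_self 0), Submodule.span_le]
    rintro _ ⟨_, ⟨j, rfl⟩, rfl⟩
    have h0 := h 0
    have hj := h j
    simp only [vsub_eq_sub, SetLike.mem_coe, LinearMap.mem_ker, innerₛₗ_apply_apply, inner_sub_right]
    linarith
  have hw : w ∈ LinearMap.ker (innerₛₗ ℝ w) := hle (htop ▸ Submodule.mem_top)
  simpa using hw

/-- Linear interpolation reproduces the gradient of an affine function. -/
theorem AffineIndependent.sum_lagrange_smul_eq {n : ℕ}
    {x : Fin (n + 1) → EuclideanSpace ℝ (Fin n)} (hx : AffineIndependent ℝ x)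
    {c : Fin (n + 1) → ℝ} {g : Fin (n + 1) → EuclideanSpace ℝ (Fin n)}
    (hlag : ∀ i j, c i + ⟪g i, x j⟫_ℝ = if i = j then (1 : ℝ) else 0)
    (a : ℝ) (v : EuclideanSpace ℝ (Fin n)) :
    ∑ i, (a + ⟪v, x i⟫_ℝ) • g i = v := by
  rw [← sub_eq_zero]
  refine hx.eq_zero_of_add_inner_eq_zero (∑ i, (a + ⟪v, x i⟫_ℝ) * c i - a) _ fun j => ?_
  have key : ∑ i, (a + ⟪v, x i⟫_ℝ) * (c i + ⟪g i, x j⟫_ℝ) = a + ⟪v, x j⟫_ℝ := by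
    simp [hlag]
  simp only [mul_add, Finset.sum_add_distrib] at key
  simp only [inner_sub_left, sum_inner, real_inner_smul_left]
  linarith

/-- First-order Taylor estimate for a function with Lipschitz gradient. -/
theorem abs_sub_sub_inner_gradient_le {E : Type*} [NormedAddCommGroup E] [InnerProductSpace ℝ E]
    [CompleteSpace E] {f : E → ℝ} {ν : ℝ} (hdiff : Differentiable ℝ f)
    (hlip : ∀ u v, ‖gradient f u - gradient f v‖ ≤ ν * ‖u - v‖) (p y : E) :
    |f y - f p - ⟪gradient f p, y - p⟫_ℝ| ≤ ν / 2 * ‖y - p‖ ^ 2 := by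
  set d := y - p with hd
  have hline (t : ℝ) : HasDerivAt (fun s : ℝ => p + s • d) d t := by
    simpa using ((hasDerivAt_id t).smul_const d).const_add p
  have hderiv (t : ℝ) :
      HasDerivAt (fun s : ℝ => f (p + s • d) - f p - s * ⟪gradient f p, d⟫_ℝ)
        (⟪gradient f (p + t • d) - gradient f p, d⟫_ℝ) t := by
    have h1 := (hdiff (p + t • d)).hasGradientAt.hasFDerivAt.comp_hasDerivAt t (hline t)
    have h2 := (h1.sub_const (f p)).sub ((hasDerivAt_id t).mul_const ⟪gradient f p, d⟫_ℝ)
    refine h2.congr_deriv ?_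
    simp [inner_sub_left]
  have hB (t : ℝ) : HasDerivAt (fun s : ℝ => ν / 2 * ‖d‖ ^ 2 * s ^ 2) (ν * ‖d‖ ^ 2 * t) t := by
    refine ((hasDerivAt_pow 2 t).const_mul (ν / 2 * ‖d‖ ^ 2)).congr_deriv ?_
    norm_num
    ring
  have h := image_norm_le_of_norm_deriv_right_le_deriv_boundary (a := 0) (b := 1)
    (fun t _ => (hderiv t).continuousAt.continuousWithinAt)
    (fun t _ => (hderiv t).hasDerivWithinAt) (by simp) hB
    (fun t ht => by
      calc _ ≤ ‖gradient f (p + t • d) - gradient f p‖ * ‖d‖ := norm_inner_le_norm _ _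
        _ ≤ ν * ‖p + t • d - p‖ * ‖d‖ := by gcongr; exact hlip _ _
        _ = ν * ‖d‖ ^ 2 * t := by
          rw [add_sub_cancel_left, norm_smul, Real.norm_of_nonneg ht.1]
          ring)
    (Set.right_mem_Icc.2 zero_le_one)
  simpa [hd] using h


open scoped InnerProductSpace

/-- Gradient approximation error of linear interpolation: writing the Lagrange polynomials
as `ℓᵢ(u) = cᵢ + ⟪gᵢ, u⟫` (so `Dℓᵢ = gᵢ` and `Df̂(x) = Σ f(xᵢ) gᵢ`), we have
`‖Df̂(x) − Df(x)‖ ≤ (ν/2) Σ ‖Dℓᵢ(x)‖ ‖xᵢ − x‖²`. -/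
theorem stmt_19 (n : ℕ) (ν : ℝ) (hν : 0 < ν)
    (f : EuclideanSpace ℝ (Fin n) → ℝ)
    (hdiff : Differentiable ℝ f)
    (hlip : ∀ u v, ‖gradient f u - gradient f v‖ ≤ ν * ‖u - v‖)
    (x : Fin (n + 1) → EuclideanSpace ℝ (Fin n)) (hx : AffineIndependent ℝ x)
    (c : Fin (n + 1) → ℝ) (g : Fin (n + 1) → EuclideanSpace ℝ (Fin n))
    (hlag : ∀ i j, c i + ⟪g i, x j⟫_ℝ = if i = j then (1 : ℝ) else 0) :
    ∀ p : EuclideanSpace ℝ (Fin n),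
      ‖(∑ i, f (x i) • g i) - gradient f p‖ ≤ ν / 2 * ∑ i, ‖g i‖ * ‖x i - p‖ ^ 2 := by
  intro p
  have hrep := hx.sum_lagrange_smul_eq hlag (f p - ⟪gradient f p, p⟫_ℝ) (gradient f p)
  have herr : (∑ i, f (x i) • g i) - gradient f p =
      ∑ i, (f (x i) - f p - ⟪gradient f p, x i - p⟫_ℝ) • g i := by
    rw [sub_eq_iff_eq_add]
    refine Eq.trans ?_ (congrArg _ hrep)
    rw [← Finset.sum_add_distrib]
    refine Finset.sum_congr rfl fun i _ => ?_
    rw [← add_smul, inner_sub_right]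
    congr 1
    ring
  rw [herr, Finset.mul_sum]
  refine norm_sum_le_of_le _ fun i _ => ?_
  rw [norm_smul, Real.norm_eq_abs]
  calc _ ≤ ν / 2 * ‖x i - p‖ ^ 2 * ‖g i‖ := by
        gcongr
        exact abs_sub_sub_inner_gradient_le hdiff hlip p (x i)
    _ = _ := by ring
end
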